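/- For every fixed θ ∈ Θ, the map θ' ↦ D_c(θ'‖θ) is convex on Θ'. -/

import Mathlib

open scoped Classical

noncomputable section

def Theta (d : ℕ) : Set (Matrix (Fin d) (Fin d) ℝ) :=
  {θ | (∀ i j, 0 < θ i j) ∧ (∑ i, ∑ j, θ i j) = 1 ∧ ∀ i, (∑ j, θ i j) = ∑ j, θ j i}

def ThetaP (d : ℕ) : Set (Matrix (Fin d) (Fin d) ℝ) :=
  {θ | (∀ i j, 0 ≤ θ i j) ∧ (∑ i, ∑ j, θ i j) = 1}

/-- Conditional relative entropy, with the conventions `0·log(0/q) = 0` and `p·log(p/0) = ∞`. -/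
def condRelEnt {d : ℕ} (θ' θ : Matrix (Fin d) (Fin d) ℝ) : EReal :=
  ∑ i, ∑ j,
    if θ' i j = 0 then (0 : EReal)
    else if θ i j = 0 then (⊤ : EReal)
    else ((θ' i j * (Real.log (θ' i j / ∑ k, θ' i k) - Real.log (θ i j / ∑ k, θ i k)) : ℝ) : EReal)

/-- Real-valued conditional relative entropy (valid whenever `θ` has positive entries,
so that no `∞` can occur; the convention `0·log(0/q) = 0` is automatic). -/
def condRelEntR {d : ℕ} (θ' θ : Matrix (Fin d) (Fin d) ℝ) : ℝ :=
  ∑ i, ∑ j, θ' i j * (Real.log (θ' i j / ∑ k, θ' i k) - Real.log (θ i j / ∑ k, θ i k))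

/-- Tangent-line lower bound for the perspective function `(x, s) ↦ x * log (x / s)`. -/
theorem mul_log_add_sub_le_mul_log_div {x s c : ℝ} (hx : 0 ≤ x) (hs : 0 ≤ s)
    (hxs : s = 0 → x = 0) (hc : 0 < c) :
    x * Real.log c + x - c * s ≤ x * Real.log (x / s) := by
  rcases hx.eq_or_lt with rfl | hx
  · simpa using mul_nonneg hc.le hs
  have hs : 0 < s := hs.lt_of_ne fun h => hx.ne' (hxs h.symm)
  have h := Real.log_le_sub_one_of_pos (show 0 < c / (x / s) by positivity)
  rw [Real.log_div hc.ne' (by positivity)] at h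
  have h' := mul_le_mul_of_nonneg_left h hx.le
  have e : x * (c / (x / s) - 1) = c * s - x := by field_simp
  linarith

/-- The log-sum inequality for two terms. -/
theorem add_mul_log_div_add_le {x s y t : ℝ} (hx : 0 ≤ x) (hs : 0 ≤ s) (hy : 0 ≤ y)
    (ht : 0 ≤ t) (hxs : s = 0 → x = 0) (hyt : t = 0 → y = 0) :
    (x + y) * Real.log ((x + y) / (s + t)) ≤
      x * Real.log (x / s) + y * Real.log (y / t) := by
  rcases (add_nonneg hx hy).eq_or_lt with h | h
  · obtain ⟨rfl, rfl⟩ := (add_eq_zero_iff_of_nonneg hx hy).1 h.symm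
    simp
  have hst : 0 < s + t := (add_nonneg hs ht).lt_of_ne fun h0 => by
    obtain ⟨h1, h2⟩ := (add_eq_zero_iff_of_nonneg hs ht).1 h0.symm
    simp [hxs h1, hyt h2] at h
  have hc := div_pos h hst
  have h1 := mul_log_add_sub_le_mul_log_div hx hs hxs hc
  have h2 := mul_log_add_sub_le_mul_log_div hy ht hyt hc
  have e : (x + y) / (s + t) * (s + t) = x + y := div_mul_cancel₀ _ hst.ne'
  linarith

/-- The function `(x, s) ↦ x * log (x / s)` is positively homogeneous. -/
theorem mul_mul_log_mul_div_mul (a x s : ℝ) :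
    a * x * Real.log (a * x / (a * s)) = a * (x * Real.log (x / s)) := by
  rcases eq_or_ne a 0 with rfl | ha
  · simp
  · rw [mul_div_mul_left _ _ ha, mul_assoc]

theorem convex_ThetaP (d : ℕ) : Convex ℝ (ThetaP d) := by
  rintro x ⟨hx, hx1⟩ y ⟨hy, hy1⟩ a b ha hb hab
  refine ⟨fun i j => ?_, ?_⟩
  · exact add_nonneg (mul_nonneg ha (hx i j)) (mul_nonneg hb (hy i j))
  · simp [Finset.sum_add_distrib, ← Finset.mul_sum, hx1, hy1, hab]

theorem stmt_2 (d : ℕ) (hd : 1 ≤ d) (θ : Matrix (Fin d) (Fin d) ℝ) (hθ : θ ∈ Theta d) :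
    ConvexOn ℝ (ThetaP d) (fun θ' => condRelEntR θ' θ) := by
  refine ⟨convex_ThetaP d, ?_⟩
  rintro x ⟨hx, -⟩ y ⟨hy, -⟩ a b ha hb -
  simp only [condRelEntR, smul_eq_mul, Finset.mul_sum, ← Finset.sum_add_distrib]
  refine Finset.sum_le_sum fun i _ => Finset.sum_le_sum fun j _ => ?_
  have vanish : ∀ (z : Matrix (Fin d) (Fin d) ℝ) (c : ℝ), (∀ i j, 0 ≤ z i j) →
      c * ∑ k, z i k = 0 → c * z i j = 0 := by
    intro z c hz h
    rcases mul_eq_zero.1 h with h | h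
    · simp [h]
    · simp [(Finset.sum_eq_zero_iff_of_nonneg fun k _ => hz i k).1 h j (Finset.mem_univ j)]
  have key := add_mul_log_div_add_le (mul_nonneg ha (hx i j))
    (mul_nonneg ha (Finset.sum_nonneg fun k _ => hx i k)) (mul_nonneg hb (hy i j))
    (mul_nonneg hb (Finset.sum_nonneg fun k _ => hy i k)) (vanish x a hx) (vanish y b hy)
  rw [mul_mul_log_mul_div_mul, mul_mul_log_mul_div_mul] at key
  simp only [Matrix.add_apply, Matrix.smul_apply, smul_eq_mul, Finset.sum_add_distrib,
    ← Finset.mul_sum]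
  linarith
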